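/- Let p : ({-1,1}^n)^d → ℝ be a block-multilinear polynomial of degree d with completely bounded norm ‖p‖_cb ≤ 1. Then p has a variable of influence at least (Var[p]/d)², i.e., there exist b ∈ [d], i ∈ [n] with Inf_{b,i}[p] ≥ (Var[p]/d)². -/

import Mathlib

noncomputable section

/-- `E m` is the Euclidean space `ℝ^m`. -/
abbrev E (m : ℕ) := EuclideanSpace ℝ (Fin m)

/-- A block-multilinear polynomial `p : ({-1,1}^n)^d → ℝ` is encoded by its Fourier
coefficients `g : (Fin d → Option (Fin n)) → ℝ`: a set `S` of pairs `(block, coordinate)`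
containing at most one pair from each block corresponds to the function `σ` with
`σ b = some i` iff `(b,i) ∈ S`.  `blockSize σ` is the cardinality `|S|`. -/
def blockSize {n d : ℕ} (σ : Fin d → Option (Fin n)) : ℕ :=
  (Finset.univ.filter fun b => (σ b).isSome).card

/-- The evaluation `p(A_1,…,A_d)` of a block-multilinear polynomial on `n`-tuples of
operators: `Σ_S p̂(S) A_{b_1}(i_1)⋯A_{b_s}(i_s)` (with identity in the blocks not
occurring in `S`, giving the ordered product over blocks `b_1 < ⋯ < b_s`). -/
def blockEval {n d m : ℕ} (g : (Fin d → Option (Fin n)) → ℝ)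
    (A : Fin d → Fin n → (E m →L[ℝ] E m)) : E m →L[ℝ] E m :=
  ∑ σ : Fin d → Option (Fin n),
    g σ • (List.ofFn fun b => Option.elim (σ b) 1 fun i => A b i).prod

/-- The completely bounded norm `‖p‖_cb`: the supremum of `‖p(A_1,…,A_d)‖_op` over all
`m` and all tuples of operators of norm at most 1. -/
def cbNorm {n d : ℕ} (g : (Fin d → Option (Fin n)) → ℝ) : ℝ :=
  sSup { r | ∃ (m : ℕ) (A : Fin d → Fin n → (E m →L[ℝ] E m)),
    (∀ b i, ‖A b i‖ ≤ 1) ∧ r = ‖blockEval g A‖ }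

/-- The influence of variable `(b,i)`: `Inf_{b,i}[p] = Σ_{S ∋ (b,i)} p̂(S)²`. -/
def inflB {n d : ℕ} (g : (Fin d → Option (Fin n)) → ℝ) (b : Fin d) (i : Fin n) : ℝ :=
  ∑ σ ∈ Finset.univ.filter (fun σ : Fin d → Option (Fin n) => σ b = some i), g σ ^ 2

/-- The variance `Var[p] = Σ_{S ≠ ∅} p̂(S)²`. -/
def varB {n d : ℕ} (g : (Fin d → Option (Fin n)) → ℝ) : ℝ :=
  ∑ σ ∈ Finset.univ.filter
      (fun σ : Fin d → Option (Fin n) => σ ≠ fun _ => none), g σ ^ 2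

/-- The list product of operators maps `v d` to `v 0` when the `k`-th operator maps
`v (k + 1)` to `v k`. -/
theorem prod_ofFn_apply_of_chain {V : Type*} [NormedAddCommGroup V] [NormedSpace ℝ V] :
    ∀ {d : ℕ} (B : Fin d → (V →L[ℝ] V)) (v : ℕ → V)
      (_ : ∀ k : Fin d, B k (v (k + 1)) = v k), (List.ofFn B).prod (v d) = v 0
  | 0, _, _, _ => by simp
  | d + 1, B, v, h => by
    have ih := prod_ofFn_apply_of_chain (fun k : Fin d => B k.succ) (fun k => v (k + 1))
      (fun k => by simpa using h k.succ)
    rw [List.ofFn_succ, List.prod_cons, mul_apply_eq_comp, ih]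
    simpa using h 0

theorem norm_list_prod_le_one {V : Type*} [NormedAddCommGroup V] [NormedSpace ℝ V]
    (l : List (V →L[ℝ] V)) (h : ∀ a ∈ l, ‖a‖ ≤ 1) : ‖l.prod‖ ≤ 1 := by
  induction l with
  | nil => exact ContinuousLinearMap.norm_id_le
  | cons a l ih =>
    rw [List.prod_cons]
    exact (norm_mul_le _ _).trans (mul_le_one₀ (h a (by simp)) (norm_nonneg _)
      (ih fun b hb => h b (by simp [hb])))

theorem norm_blockEval_le {n d m : ℕ} (g : (Fin d → Option (Fin n)) → ℝ)
    (A : Fin d → Fin n → (E m →L[ℝ] E m)) (hA : ∀ b i, ‖A b i‖ ≤ 1) :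
    ‖blockEval g A‖ ≤ ∑ σ, |g σ| := by
  refine (norm_sum_le _ _).trans (Finset.sum_le_sum fun σ _ => ?_)
  rw [norm_smul, Real.norm_eq_abs]
  refine mul_le_of_le_one_right (abs_nonneg _) (norm_list_prod_le_one _ fun a ha => ?_)
  obtain ⟨b, rfl⟩ := List.mem_ofFn.1 ha
  cases σ b with
  | none => exact ContinuousLinearMap.norm_id_le
  | some i => exact hA b i

theorem norm_blockEval_le_cbNorm {n d m : ℕ} (g : (Fin d → Option (Fin n)) → ℝ)
    (A : Fin d → Fin n → (E m →L[ℝ] E m)) (hA : ∀ b i, ‖A b i‖ ≤ 1) :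
    ‖blockEval g A‖ ≤ cbNorm g := by
  refine le_csSup ⟨∑ σ, |g σ|, ?_⟩ ⟨m, A, hA, rfl⟩
  rintro r ⟨m, A, hA, rfl⟩
  exact norm_blockEval_le g A hA

/-- A partial injection of an orthonormal family is realised by a contraction. -/
theorem exists_contraction_of_injOn {V ι : Type*} [NormedAddCommGroup V]
    [InnerProductSpace ℝ V] [Fintype ι] {e : ι → V} (he : Orthonormal ℝ e)
    (s : Set ι) (φ : ι → ι) (hφ : Set.InjOn φ s) :
    ∃ T : V →L[ℝ] V, ‖T‖ ≤ 1 ∧ ∀ x ∈ s, T (e x) = e (φ x) := by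
  classical
  have hes : Orthonormal ℝ (fun x : s => e x) := he.comp _ Subtype.val_injective
  have hφs : Orthonormal ℝ (fun x : s => e (φ x)) := he.comp _ hφ.injective
  refine ⟨∑ x : s, (innerSL ℝ (e x)).smulRight (e (φ x)), ?_, fun x hx => ?_⟩
  · refine ContinuousLinearMap.opNorm_le_bound _ zero_le_one fun w => ?_
    rw [one_mul]
    refine le_of_sq_le_sq ?_ (norm_nonneg _)
    have h := hφs.inner_sum (fun x => inner ℝ (e x) w) (fun x => inner ℝ (e x) w) Finset.univ
    have hb := hes.sum_inner_products_le (x := w) (s := Finset.univ)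
    simp only [FunLike.coe_sum, Finset.sum_apply, ContinuousLinearMap.smulRight_apply,
      innerSL_apply_apply]
    rw [← real_inner_self_eq_norm_sq, h]
    refine le_trans (le_of_eq ?_) hb
    refine Finset.sum_congr rfl fun x _ => ?_
    simp [sq]
  · simp only [FunLike.coe_sum, Finset.sum_apply, ContinuousLinearMap.smulRight_apply,
      innerSL_apply_apply]
    rw [Finset.sum_eq_single ⟨x, hx⟩]
    · simp [he.1 x]
    · intro y _ hy
      rw [he.2 (fun h => hy (Subtype.ext h)), zero_smul]
    · simp

/-- The sets of pairs whose first block is `b`, with coordinate `i` there. -/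
def firstAt {n d : ℕ} (b : Fin d) (i : Fin n) : Finset (Fin d → Option (Fin n)) :=
  Finset.univ.filter fun σ => σ b = some i ∧ ∀ c < b, σ c = none

/-- The part of `σ` in the blocks from `k` on. -/
def restrictFrom {n d : ℕ} (σ : Fin d → Option (Fin n)) (k : ℕ) : Fin d → Option (Fin n) :=
  fun c => if k ≤ c then σ c else none

theorem restrictFrom_of_none {n d : ℕ} (σ : Fin d → Option (Fin n)) (k : Fin d)
    (h : σ k = none) : restrictFrom σ (k + 1) = restrictFrom σ k := by
  funext c
  unfold restrictFrom
  rcases eq_or_ne c k with rfl | hc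
  · simp [h]
  · have : (c : ℕ) ≠ k := fun h => hc (Fin.ext h)
    have : (k : ℕ) + 1 ≤ c ↔ (k : ℕ) ≤ c := by omega
    simp only [this]

theorem update_restrictFrom {n d : ℕ} (σ : Fin d → Option (Fin n)) (k : Fin d) :
    Function.update (restrictFrom σ (k + 1)) k (σ k) = restrictFrom σ k := by
  funext c
  rcases eq_or_ne c k with rfl | hc
  · simp [restrictFrom]
  · have : (c : ℕ) ≠ k := fun h => hc (Fin.ext h)
    have : (k : ℕ) + 1 ≤ c ↔ (k : ℕ) ≤ c := by omega
    simp [restrictFrom, this, hc]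

theorem restrictFrom_of_mem_firstAt {n d : ℕ} {σ : Fin d → Option (Fin n)} {b : Fin d}
    {i : Fin n} (h : σ ∈ firstAt b i) : restrictFrom σ b = σ := by
  funext c
  simp only [firstAt, Finset.mem_filter] at h
  unfold restrictFrom
  split_ifs with hc
  · rfl
  · exact (h.2.2 c (by simpa using hc)).symm

theorem sum_sqrt_firstAt_le_cbNorm {n d : ℕ} (g : (Fin d → Option (Fin n)) → ℝ) (b : Fin d) :
    ∑ i, √(∑ σ ∈ firstAt b i, g σ ^ 2) ≤ cbNorm g := by
  classical
  set ι := Option (Fin d → Option (Fin n))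
  set m := Fintype.card ι
  obtain ⟨e, he⟩ : ∃ e : ι → E m, Orthonormal ℝ e :=
    ⟨_, (EuclideanSpace.basisFun (Fin m) ℝ).orthonormal.comp _ (Fintype.equivFin ι).injective⟩
  have hes : Orthonormal ℝ (fun σ => e (some σ)) := he.comp _ (Option.some_injective _)
  have hT : ∀ (c : Fin d) (i : Fin n), ∃ T : E m →L[ℝ] E m, ‖T‖ ≤ 1 ∧
      ∀ τ, τ c = none → T (e (some τ)) = e (some (Function.update τ c (some i))) := by
    intro c i
    obtain ⟨T, h1, h2⟩ := exists_contraction_of_injOn he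
      (some '' {τ : Fin d → Option (Fin n) | τ c = none})
      (Option.map fun τ => Function.update τ c (some i)) (by
        rintro _ ⟨τ, hτ, rfl⟩ _ ⟨ρ, hρ, rfl⟩ h
        simp only [Option.map_some] at h
        congr 1
        funext k
        rcases eq_or_ne k c with rfl | hk
        · exact hτ.trans hρ.symm
        · simpa [hk] using congrFun (Option.some_injective _ h) k)
    exact ⟨T, h1, fun τ hτ => h2 _ ⟨τ, hτ, rfl⟩⟩
  choose T hT1 hT2 using hT
  set I : Fin n → ℝ := fun i => ∑ σ ∈ firstAt b i, g σ ^ 2 with hI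
  set u : Fin n → E m := fun i => (√(I i))⁻¹ • ∑ σ ∈ firstAt b i, g σ • e (some σ) with hu
  have hu1 : ∀ i, ‖u i‖ ≤ 1 := by
    intro i
    have h := hes.inner_sum g g (firstAt b i)
    rw [real_inner_self_eq_norm_sq] at h
    have h2 : ‖∑ σ ∈ firstAt b i, g σ • e (some σ)‖ = √(I i) := by
      rw [← Real.sqrt_sq (norm_nonneg _), h]
      congr 1
      exact Finset.sum_congr rfl fun σ _ => by simp [sq]
    rw [hu, norm_smul, h2, Real.norm_of_nonneg (by positivity)]
    exact inv_mul_le_one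
  have hu2 : ∀ i, ∀ σ ∈ firstAt b i, inner ℝ (u i) (e (some σ)) = (√(I i))⁻¹ * g σ := by
    intro i σ hσ
    have h := hes.inner_left_sum g hσ
    rw [hu, real_inner_smul_left, h]
    simp
  set A : Fin d → Fin n → (E m →L[ℝ] E m) := fun c i =>
    if c < b then 0 else if c = b then ((innerSL ℝ (u i)).smulRight (e none)) * T b i
    else T c i with hAdef
  have hA : ∀ c i, ‖A c i‖ ≤ 1 := by
    intro c i
    simp only [hAdef]
    split_ifs
    · simp
    · refine (norm_mul_le _ _).trans (mul_le_one₀ ?_ (norm_nonneg _) (hT1 b i))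
      rw [ContinuousLinearMap.norm_smulRight_apply, innerSL_apply_norm, he.1, mul_one]
      exact hu1 i
    · exact hT1 c i
  set v : (Fin d → Option (Fin n)) → ℕ → E m := fun σ k =>
    if k ≤ b then
      if ∃ c : Fin d, k ≤ c ∧ c < b ∧ σ c ≠ none then 0
      else (σ b).elim (e (some (restrictFrom σ k)))
        fun i => inner ℝ (u i) (e (some (restrictFrom σ b))) • e none
    else e (some (restrictFrom σ k)) with hv
  have hTr : ∀ (σ : Fin d → Option (Fin n)) (k : Fin d) (i : Fin n), σ k = some i →
      T k i (e (some (restrictFrom σ (k + 1)))) = e (some (restrictFrom σ k)) := by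
    intro σ k i h
    rw [hT2 k i _ (by simp [restrictFrom]), ← h, update_restrictFrom]
  have hchain : ∀ σ (k : Fin d),
      (Option.elim (σ k) 1 fun i => A k i) (v σ (k + 1)) = v σ k := by
    intro σ k
    rcases lt_trichotomy k b with hk | rfl | hk
    · have hk1 : (k : ℕ) + 1 ≤ b := hk
      have hk2 : (k : ℕ) ≤ b := hk.le
      cases hσ : σ k with
      | none =>
        have hiff : (∃ c : Fin d, (k : ℕ) + 1 ≤ c ∧ c < b ∧ σ c ≠ none) ↔
            ∃ c : Fin d, (k : ℕ) ≤ c ∧ c < b ∧ σ c ≠ none := by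
          refine exists_congr fun c => ⟨fun h => ⟨by omega, h.2⟩, fun h => ⟨?_, h.2⟩⟩
          have : (c : ℕ) ≠ k := fun hc => h.2.2 (by rw [Fin.ext hc, hσ])
          omega
        simp only [hv, hk1, hk2, if_true, hiff, restrictFrom_of_none σ k hσ, Option.elim_none,
          one_apply_eq_self]
      | some i =>
        have hex : ∃ c : Fin d, (k : ℕ) ≤ c ∧ c < b ∧ σ c ≠ none := ⟨k, le_rfl, hk, by simp [hσ]⟩
        simp only [hv, hk2, if_true, if_pos hex, hAdef, hk, Option.elim_some,
          zero_apply]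
    · have hex : ¬ ∃ c : Fin d, (k : ℕ) ≤ c ∧ c < k ∧ σ c ≠ none := by
        rintro ⟨c, h1, h2, -⟩
        exact absurd h2 (not_lt.2 h1)
      have hk1 : ¬ (k : ℕ) + 1 ≤ k := by omega
      cases hσ : σ k with
      | none =>
        simp only [hv, hk1, le_refl, if_true, if_false, if_neg hex, hσ, Option.elim_none,
          restrictFrom_of_none σ k hσ, one_apply_eq_self]
      | some i =>
        simp only [hv, hk1, le_refl, if_true, if_false, if_neg hex, hσ, Option.elim_some,
          hAdef, lt_irrefl, mul_apply_eq_comp, hTr σ k i hσ,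
          ContinuousLinearMap.smulRight_apply, innerSL_apply_apply]
    · have hk1 : ¬ (k : ℕ) + 1 ≤ b := by have : (b : ℕ) < k := hk; omega
      have hk2 : ¬ (k : ℕ) ≤ b := not_le.2 hk
      cases hσ : σ k with
      | none =>
        simp only [hv, hk1, hk2, if_false, Option.elim_none,
          restrictFrom_of_none σ k hσ, one_apply_eq_self]
      | some i =>
        simp only [hv, hk1, hk2, if_false, Option.elim_some, hAdef, not_lt.2 hk.le, hk.ne',
          hTr σ k i hσ]
  have hvd : ∀ σ, v σ d = e (some fun _ => none) := by
    intro σ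
    have hd : ¬ d ≤ (b : ℕ) := not_le.2 b.2
    simp only [hv, hd, if_false]
    congr 2
    funext c
    simp [restrictFrom, c.2]
  have hv0 : ∀ σ, inner ℝ (e none) (v σ 0) =
      ∑ i, if σ ∈ firstAt b i then (√(I i))⁻¹ * g σ else 0 := by
    intro σ
    simp only [hv, Nat.zero_le, if_true, true_and]
    split_ifs with hex
    · rw [inner_zero_right, Finset.sum_eq_zero]
      intro i _
      obtain ⟨c, hc, hcn⟩ := hex
      rw [if_neg]
      intro h
      simp only [firstAt, Finset.mem_filter] at h
      exact hcn (h.2.2 c hc)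
    · push Not at hex
      cases hσ : σ b with
      | none =>
        rw [Option.elim_none, he.2 (by simp), Finset.sum_eq_zero]
        intro i _
        rw [if_neg]
        simp [firstAt, hσ]
      | some i =>
        have hm : σ ∈ firstAt b i := by
          simp only [firstAt, Finset.mem_filter, Finset.mem_univ, true_and]
          exact ⟨hσ, hex⟩
        rw [Option.elim_some, real_inner_smul_right, real_inner_self_eq_norm_sq, he.1,
          restrictFrom_of_mem_firstAt hm, hu2 i σ hm, Finset.sum_eq_single i]
        · simp [hm]
        · intro j _ hj
          rw [if_neg]
          simp [firstAt, hσ, hj.symm]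
        · simp
  have heval : blockEval g A (e (some fun _ => none)) = ∑ σ, g σ • v σ 0 := by
    simp only [blockEval, FunLike.coe_sum, Finset.sum_apply, smul_apply]
    refine Finset.sum_congr rfl fun σ _ => ?_
    rw [← hvd σ, prod_ofFn_apply_of_chain _ (v σ) (hchain σ)]
  have hinner : inner ℝ (e none) (blockEval g A (e (some fun _ => none))) = ∑ i, √(I i) := by
    rw [heval, inner_sum]
    simp only [real_inner_smul_right, hv0, Finset.mul_sum]
    rw [Finset.sum_comm]
    refine Finset.sum_congr rfl fun i _ => ?_
    simp only [mul_ite, mul_zero]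
    rw [← Finset.sum_filter, Finset.filter_mem_eq_inter, Finset.univ_inter]
    calc ∑ σ ∈ firstAt b i, g σ * ((√(I i))⁻¹ * g σ)
        = I i / √(I i) := by
          rw [div_eq_mul_inv, hI, Finset.sum_mul]
          exact Finset.sum_congr rfl fun σ _ => by ring
      _ = √(I i) := Real.div_sqrt
  rw [← hinner]
  refine (real_inner_le_norm _ _).trans ?_
  rw [he.1, one_mul]
  refine (ContinuousLinearMap.le_opNorm _ _).trans ?_
  rw [he.1, mul_one]
  exact norm_blockEval_le_cbNorm g A hA

theorem varB_le_sum_firstAt {n d : ℕ} (g : (Fin d → Option (Fin n)) → ℝ) :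
    varB g ≤ ∑ b, ∑ i, ∑ σ ∈ firstAt b i, g σ ^ 2 := by
  classical
  have hcover : Finset.univ.filter (fun σ : Fin d → Option (Fin n) => σ ≠ fun _ => none) ⊆
      (Finset.univ : Finset (Fin d × Fin n)).biUnion fun q => firstAt q.1 q.2 := by
    intro σ hσ
    have hne : ∃ b, σ b ≠ none := by
      by_contra! h
      exact (Finset.mem_filter.1 hσ).2 (funext h)
    obtain ⟨b, hb, hmin⟩ := WellFounded.has_min (wellFounded_lt (α := Fin d))
      {b | σ b ≠ none} hne
    obtain ⟨i, hi⟩ := Option.ne_none_iff_exists'.1 hb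
    simp only [Finset.mem_biUnion, Finset.mem_univ, true_and, Prod.exists, firstAt,
      Finset.mem_filter]
    exact ⟨b, i, hi, fun c hc => by_contra fun h => hmin c h hc⟩
  rw [← Fintype.sum_prod_type' (f := fun b i => ∑ σ ∈ firstAt b i, g σ ^ 2)]
  refine (Finset.sum_le_sum_of_subset_of_nonneg hcover fun _ _ _ => sq_nonneg _).trans ?_
  refine (Finset.sum_biUnion fun p _ q _ hpq => ?_).le
  refine Finset.disjoint_left.2 fun σ hp hq => hpq ?_
  simp only [firstAt, Finset.mem_filter, Finset.mem_univ, true_and] at hp hq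
  have hb : p.1 = q.1 := by
    rcases lt_trichotomy p.1 q.1 with h | h | h
    · simpa [hp.1] using hq.2 _ h
    · exact h
    · simpa [hq.1] using hp.2 _ h
  exact Prod.ext hb (Option.some_injective _ (by rw [← hp.1, ← hq.1, hb]))

theorem sum_firstAt_le_inflB {n d : ℕ} (g : (Fin d → Option (Fin n)) → ℝ) (b : Fin d)
    (i : Fin n) : ∑ σ ∈ firstAt b i, g σ ^ 2 ≤ inflB g b i := by
  refine Finset.sum_le_sum_of_subset_of_nonneg (fun σ hσ => ?_) fun _ _ _ => sq_nonneg _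
  simp only [firstAt, Finset.mem_filter] at hσ ⊢
  exact ⟨hσ.1, hσ.2.1⟩

/-- A block-multilinear polynomial of degree `d` with `‖p‖_cb ≤ 1`
has a variable of influence at least `(Var[p]/d)²`. -/
theorem stmt_3 {n d : ℕ} (hn : 0 < n) (hd : 0 < d)
    (g : (Fin d → Option (Fin n)) → ℝ) (hcb : cbNorm g ≤ 1) :
    ∃ (b : Fin d) (i : Fin n), (varB g / d) ^ 2 ≤ inflB g b i := by
  have : Nonempty (Fin d × Fin n) := ⟨⟨0, hd⟩, ⟨0, hn⟩⟩
  obtain ⟨⟨b₀, i₀⟩, hmax⟩ := Finite.exists_max fun q : Fin d × Fin n => inflB g q.1 q.2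
  refine ⟨b₀, i₀, ?_⟩
  have h0 : 0 ≤ inflB g b₀ i₀ := Finset.sum_nonneg fun _ _ => sq_nonneg _
  have hV : 0 ≤ varB g := Finset.sum_nonneg fun _ _ => sq_nonneg _
  have hblock : ∀ b : Fin d, ∑ i, ∑ σ ∈ firstAt b i, g σ ^ 2 ≤ √(inflB g b₀ i₀) := by
    intro b
    calc ∑ i, ∑ σ ∈ firstAt b i, g σ ^ 2
        ≤ ∑ i, √(inflB g b₀ i₀) * √(∑ σ ∈ firstAt b i, g σ ^ 2) := by
          refine Finset.sum_le_sum fun i _ => ?_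
          have hI : 0 ≤ ∑ σ ∈ firstAt b i, g σ ^ 2 := Finset.sum_nonneg fun _ _ => sq_nonneg _
          calc ∑ σ ∈ firstAt b i, g σ ^ 2
              = √(∑ σ ∈ firstAt b i, g σ ^ 2) * √(∑ σ ∈ firstAt b i, g σ ^ 2) :=
                (Real.mul_self_sqrt hI).symm
            _ ≤ _ := mul_le_mul_of_nonneg_right
                (Real.sqrt_le_sqrt ((sum_firstAt_le_inflB g b i).trans (hmax (b, i))))
                (Real.sqrt_nonneg _)
      _ = √(inflB g b₀ i₀) * ∑ i, √(∑ σ ∈ firstAt b i, g σ ^ 2) := by rw [Finset.mul_sum]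
      _ ≤ √(inflB g b₀ i₀) := mul_le_of_le_one_right (Real.sqrt_nonneg _)
          ((sum_sqrt_firstAt_le_cbNorm g b).trans hcb)
  have hd' : (0 : ℝ) < d := by exact_mod_cast hd
  have hle : varB g / d ≤ √(inflB g b₀ i₀) := by
    rw [div_le_iff₀' hd']
    refine (varB_le_sum_firstAt g).trans ((Finset.sum_le_sum fun b _ => hblock b).trans ?_)
    simp
  calc (varB g / d) ^ 2 ≤ √(inflB g b₀ i₀) ^ 2 := pow_le_pow_left₀ (by positivity) hle 2
    _ = inflB g b₀ i₀ := Real.sq_sqrt h0
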